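/- The complex matrix group generated by diag(1, i) and (1/√2)·[[1,1],[1,−1]] is finite of order 192. -/

import Mathlib

/-- Representatives for the left cosets, in the group generated by `A` and `B`, of the subgroup
generated by `A` and the central element `(A * B) ^ 3`. -/
def cosetRep {G : Type*} [Group G] (A B : G) : Fin 6 → G :=
  ![1, B * A ^ 2 * B, B, A * B, A ^ 2 * B, A ^ 3 * B]

/-- The normal form `z ^ s * w * A ^ k`, with `z = (A * B) ^ 3` and `w` a coset representative. -/
def normalForm {G : Type*} [Group G] (A B : G) (p : Fin 8 × Fin 6 × Fin 4) : G :=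
  ((A * B) ^ 3) ^ (p.1 : ℕ) * cosetRep A B p.2.1 * A ^ (p.2.2 : ℕ)

section Group

variable {G : Type*} [Group G] {A B : G}

theorem mem_range_normalForm (hA : A ^ 4 = 1) (hz : ((A * B) ^ 3) ^ 8 = 1) (s : ℕ) (j : Fin 6)
    (k : ℕ) : ((A * B) ^ 3) ^ s * cosetRep A B j * A ^ k ∈ Set.range (normalForm A B) := by
  refine ⟨(⟨s % 8, Nat.mod_lt _ (by norm_num)⟩, j, ⟨k % 4, Nat.mod_lt _ (by norm_num)⟩), ?_⟩
  simp only [normalForm]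
  rw [← pow_eq_pow_mod s hz, ← pow_eq_pow_mod k hA]

theorem mul_mem_range_normalForm (hA : A ^ 4 = 1) (hz : ((A * B) ^ 3) ^ 8 = 1) {C : G}
    (hC : Commute ((A * B) ^ 3) C)
    (h : ∀ j, ∃ s j' k, C * cosetRep A B j = ((A * B) ^ 3) ^ s * cosetRep A B j' * A ^ k)
    {g : G} (hg : g ∈ Set.range (normalForm A B)) : C * g ∈ Set.range (normalForm A B) := by
  obtain ⟨⟨s, j, k⟩, rfl⟩ := hg
  obtain ⟨s', j', k', h⟩ := h j
  have key : C * normalForm A B (s, j, k)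
      = ((A * B) ^ 3) ^ ((s : ℕ) + s') * cosetRep A B j' * A ^ (k' + (k : ℕ)) := by
    simp only [normalForm]
    rw [← mul_assoc, ← mul_assoc, ← (hC.pow_left s).eq, mul_assoc _ C, h, pow_add _ (s : ℕ),
      pow_add]
    simp only [mul_assoc]
  exact key ▸ mem_range_normalForm hA hz _ _ _

theorem normalForm_mem_closure (p : Fin 8 × Fin 6 × Fin 4) :
    normalForm A B p ∈ Subgroup.closure {A, B} := by
  have hA : A ∈ Subgroup.closure {A, B} := Subgroup.subset_closure (by simp)
  have hB : B ∈ Subgroup.closure {A, B} := Subgroup.subset_closure (by simp)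
  obtain ⟨s, j, k⟩ := p
  refine mul_mem (mul_mem (pow_mem (pow_mem (mul_mem hA hB) _) _) ?_) (pow_mem hA _)
  fin_cases j
  · exact one_mem _
  · exact mul_mem (mul_mem hB (pow_mem hA _)) hB
  · exact hB
  · exact mul_mem hA hB
  · exact mul_mem (pow_mem hA _) hB
  · exact mul_mem (pow_mem hA _) hB

theorem closure_eq_range_normalForm (hA : A ^ 4 = 1) (hB : B ^ 2 = 1)
    (hz : ((A * B) ^ 3) ^ 8 = 1) (hzA : Commute ((A * B) ^ 3) A) (hzB : Commute ((A * B) ^ 3) B)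
    (hAX : A * (B * A ^ 2 * B) = ((A * B) ^ 3) ^ 2 * (B * A ^ 2 * B) * A ^ 3)
    (hBAB : B * (A * B) = (A * B) ^ 3 * (A ^ 3 * B) * A ^ 3)
    (hBA3B : B * (A ^ 3 * B) = ((A * B) ^ 3) ^ 7 * (A * B) * A) :
    (Subgroup.closure {A, B} : Set G) = Set.range (normalForm A B) := by
  have hBB : B * B = 1 := by rw [← sq, hB]
  have mulA {g : G} (hg : g ∈ Set.range (normalForm A B)) :
      A * g ∈ Set.range (normalForm A B) := by
    refine mul_mem_range_normalForm hA hz hzA (fun j => ?_) hg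
    fin_cases j
    · exact ⟨0, 0, 1, by simp [cosetRep]⟩
    · exact ⟨2, 1, 3, hAX⟩
    · exact ⟨0, 3, 0, by simp [cosetRep]⟩
    · exact ⟨0, 4, 0, by simp [cosetRep, pow_succ, mul_assoc]⟩
    · exact ⟨0, 5, 0, by simp [cosetRep, pow_succ, mul_assoc]⟩
    · refine ⟨0, 2, 0, ?_⟩
      change A * (A ^ 3 * B) = _ ^ 0 * B * A ^ 0
      rw [← mul_assoc, ← pow_succ', hA]
      simp
  have mulB {g : G} (hg : g ∈ Set.range (normalForm A B)) :
      B * g ∈ Set.range (normalForm A B) := by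
    refine mul_mem_range_normalForm hA hz hzB (fun j => ?_) hg
    fin_cases j
    · exact ⟨0, 2, 0, by simp [cosetRep]⟩
    · refine ⟨0, 4, 0, ?_⟩
      change B * (B * A ^ 2 * B) = _ ^ 0 * (A ^ 2 * B) * A ^ 0
      rw [← mul_assoc, ← mul_assoc, hBB]
      simp
    · exact ⟨0, 0, 0, by simp [cosetRep, hBB]⟩
    · exact ⟨1, 5, 3, by simpa [cosetRep] using hBAB⟩
    · exact ⟨0, 1, 0, by simp [cosetRep, mul_assoc]⟩
    · exact ⟨7, 3, 1, by simpa [cosetRep] using hBA3B⟩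
  refine Set.Subset.antisymm (fun g hg => ?_) ?_
  · have invA : A⁻¹ = A * (A * A) := by
      rw [inv_eq_iff_mul_eq_one, ← hA]; simp [pow_succ, mul_assoc]
    have invB : B⁻¹ = B := by rw [inv_eq_iff_mul_eq_one, hBB]
    induction hg using Subgroup.closure_induction_left with
    | one => simpa [cosetRep] using mem_range_normalForm hA hz 0 0 0
    | mul_left x hx y _ ih =>
      rcases hx with rfl | rfl
      exacts [mulA ih, mulB ih]
    | inv_mul_cancel x hx y _ ih =>
      rcases hx with rfl | rfl
      · rw [invA, mul_assoc, mul_assoc]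
        exact mulA (mulA (mulA ih))
      · rw [invB]
        exact mulB ih
  · rintro _ ⟨p, rfl⟩
    exact normalForm_mem_closure p

end Group

/-- Two of the coset representatives whose first columns are parallel coincide. -/
theorem eq_of_firstColumn_parallel {r : ℂ} (hr : r ≠ 0) {j j' : Fin 6}
    (h : (![1, 0, r, r, r, r] : Fin 6 → ℂ) j *
        (![0, 1, r, Complex.I * r, -r, -Complex.I * r] : Fin 6 → ℂ) j'
      = (![0, 1, r, Complex.I * r, -r, -Complex.I * r] : Fin 6 → ℂ) j *
        (![1, 0, r, r, r, r] : Fin 6 → ℂ) j') : j = j' := by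
  have hI : Complex.I ^ 2 = -1 := Complex.I_sq
  fin_cases j <;> fin_cases j' <;> first | rfl | (exfalso; simp at h <;> grind)

/-- The group of complex 2×2 matrices generated by `diag(1, i)` and
`(1/√2)·[[1,1],[1,−1]]` is finite of order 192. -/
theorem gleason_typeII_group_order
    (A B : (Matrix (Fin 2) (Fin 2) ℂ)ˣ)
    (hA : (A : Matrix (Fin 2) (Fin 2) ℂ) = !![1, 0; 0, Complex.I])
    (hB : (B : Matrix (Fin 2) (Fin 2) ℂ)
      = ((Real.sqrt 2 : ℂ))⁻¹ • !![1, 1; 1, -1]) :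
    Nat.card (Subgroup.closure {A, B} : Subgroup (Matrix (Fin 2) (Fin 2) ℂ)ˣ) = 192 := by
  obtain ⟨r, hr⟩ : ∃ r : ℂ, r = (Real.sqrt 2 : ℂ)⁻¹ := ⟨_, rfl⟩
  have hr2 : r ^ 2 = 1 / 2 := by
    rw [hr, inv_pow, ← Complex.ofReal_pow, Real.sq_sqrt (by norm_num)]; norm_num
  have hr0 : r ≠ 0 := by rintro rfl; norm_num at hr2
  have hI : Complex.I ^ 2 = -1 := Complex.I_sq
  have hB : (B : Matrix (Fin 2) (Fin 2) ℂ) = !![r, r; r, -r] := by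
    rw [hB, ← hr]; simp
  clear hr
  obtain ⟨ζ, hζ⟩ : ∃ ζ : ℂ, ζ = r * (1 + Complex.I) := ⟨_, rfl⟩
  have hζ2 : ζ ^ 2 = Complex.I := by rw [hζ]; grind
  have hζ4 : ζ ^ 4 = -1 := by rw [← hI, ← hζ2]; ring
  have hζ0 : ζ ≠ 0 := by rintro rfl; norm_num at hζ4
  have hζo : orderOf ζ = 2 ^ 3 := by
    refine orderOf_eq_prime_pow ?_ ?_
    · norm_num [hζ4]
    · linear_combination (ζ ^ 4 - 1) * hζ4
  have hIo : orderOf Complex.I = 2 ^ 2 := by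
    refine orderOf_eq_prime_pow ?_ ?_
    · norm_num
    · linear_combination (Complex.I ^ 2 - 1) * hI
  have hApow (k : ℕ) : ((A ^ k : (Matrix (Fin 2) (Fin 2) ℂ)ˣ) : Matrix (Fin 2) (Fin 2) ℂ)
      = !![1, 0; 0, Complex.I ^ k] := by
    induction k with
    | zero => simp [Matrix.one_fin_two]
    | succ k ih => rw [pow_succ, Units.val_mul, ih, hA]; simp [pow_succ]
  have hz : (((A * B) ^ 3 : (Matrix (Fin 2) (Fin 2) ℂ)ˣ) : Matrix (Fin 2) (Fin 2) ℂ)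
      = !![ζ, 0; 0, ζ] := by
    rw [Units.val_pow_eq_pow_val, Units.val_mul, hA, hB]
    ext i j
    fin_cases i <;> fin_cases j <;> simp [pow_succ] <;> grind
  have hzpow (s : ℕ) : ((((A * B) ^ 3) ^ s : (Matrix (Fin 2) (Fin 2) ℂ)ˣ) :
      Matrix (Fin 2) (Fin 2) ℂ) = !![ζ ^ s, 0; 0, ζ ^ s] := by
    induction s with
    | zero => simp [Matrix.one_fin_two]
    | succ s ih => rw [pow_succ, Units.val_mul, ih, hz]; simp [pow_succ]
  have hX : ((B * A ^ 2 * B : (Matrix (Fin 2) (Fin 2) ℂ)ˣ) : Matrix (Fin 2) (Fin 2) ℂ)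
      = !![0, 1; 1, 0] := by
    rw [Units.val_mul, Units.val_mul, hApow, hB]
    ext i j
    fin_cases i <;> fin_cases j <;> simp <;> grind
  have hrange : (Subgroup.closure {A, B} : Set (Matrix (Fin 2) (Fin 2) ℂ)ˣ)
      = Set.range (normalForm A B) := by
    refine closure_eq_range_normalForm ?_ ?_ ?_ ?_ ?_ ?_ ?_ ?_ <;> refine Units.ext ?_
    · rw [hApow]; simp [Matrix.one_fin_two]
    · rw [Units.val_pow_eq_pow_val, hB]
      ext i j
      fin_cases i <;> fin_cases j <;> simp [pow_succ] <;> grind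
    · rw [hzpow, show ζ ^ 8 = 1 by linear_combination (ζ ^ 4 - 1) * hζ4]
      simp [Matrix.one_fin_two]
    · rw [Units.val_mul, Units.val_mul, hz, hA]
      simp [mul_comm]
    · rw [Units.val_mul, Units.val_mul, hz, hB]
      simp [mul_comm]
    · rw [Units.val_mul, Units.val_mul _ (A ^ 3), Units.val_mul (((A * B) ^ 3) ^ 2), hX, hzpow,
        hApow, hA]
      ext i j
      fin_cases i <;> fin_cases j <;> simp <;> grind
    · simp only [Units.val_mul, hz, hApow, hA, hB]
      ext i j
      fin_cases i <;> fin_cases j <;> simp <;> grind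
    · simp only [Units.val_mul, hzpow, hApow, hA, hB]
      have hζ7 : ζ ^ 7 = r * (1 - Complex.I) := by grind
      ext i j
      fin_cases i <;> fin_cases j <;> simp [hζ7] <;> grind
  have hinj : Function.Injective (normalForm A B) := by
    rintro ⟨s, j, k⟩ ⟨s', j', k'⟩ h
    obtain ⟨u, hu⟩ : ∃ u : Fin 6 → ℂ, u = ![1, 0, r, r, r, r] := ⟨_, rfl⟩
    obtain ⟨v, hv⟩ : ∃ v : Fin 6 → ℂ, v = ![0, 1, r, Complex.I * r, -r, -Complex.I * r] :=
      ⟨_, rfl⟩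
    have hrep (j : Fin 6) : (cosetRep A B j).val 0 0 = u j ∧
        (cosetRep A B j).val 1 0 = v j := by
      fin_cases j
      · simp [cosetRep, hu, hv]
      · change (B * A ^ 2 * B : (Matrix (Fin 2) (Fin 2) ℂ)ˣ).val 0 0 = _ ∧
          (B * A ^ 2 * B : (Matrix (Fin 2) (Fin 2) ℂ)ˣ).val 1 0 = _
        rw [hX]
        simp [hu, hv]
      · simp [cosetRep, hu, hv, hB]
      · simp [cosetRep, hu, hv, hA, hB]
      · simp [cosetRep, hu, hv, hA, hB, pow_succ]
      · simp [cosetRep, hu, hv, hA, hB, pow_succ]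
    have hcol (s : Fin 8) (j : Fin 6) (k : Fin 4) :
        (normalForm A B (s, j, k)).val 0 0 = ζ ^ (s : ℕ) * u j ∧
        (normalForm A B (s, j, k)).val 1 0 = ζ ^ (s : ℕ) * v j := by
      simp only [normalForm, Units.val_mul _ (A ^ _), Units.val_mul _ (cosetRep A B j), hzpow,
        hApow, ← (hrep j).1, ← (hrep j).2]
      simp [Matrix.vecMul, dotProduct, Matrix.mul_apply, Fin.sum_univ_two]
    have h0 : ζ ^ (s : ℕ) * u j = ζ ^ (s' : ℕ) * u j' := by
      rw [← (hcol s j k).1, h, (hcol _ _ _).1]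
    have h1 : ζ ^ (s : ℕ) * v j = ζ ^ (s' : ℕ) * v j' := by
      rw [← (hcol s j k).2, h, (hcol _ _ _).2]
    have hdet : u j * v j' = v j * u j' := by
      refine mul_left_cancel₀ (mul_ne_zero (pow_ne_zero s hζ0) (pow_ne_zero s' hζ0)) ?_
      linear_combination ζ ^ (s' : ℕ) * v j' * h0 - ζ ^ (s' : ℕ) * u j' * h1
    have hj : j = j' := by
      subst hu hv
      exact eq_of_firstColumn_parallel hr0 hdet
    subst hj
    have hs : ζ ^ (s : ℕ) = ζ ^ (s' : ℕ) := by
      have : u j ≠ 0 ∨ v j ≠ 0 := by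
        subst hu hv
        fin_cases j <;> simp [hr0]
      rcases this with hj | hj
      exacts [mul_right_cancel₀ hj h0, mul_right_cancel₀ hj h1]
    have hs : s = s' := Fin.ext <| pow_injOn_Iio_orderOf (by simp [hζo]) (by simp [hζo]) hs
    subst hs
    have hk : A ^ (k : ℕ) = A ^ (k' : ℕ) := mul_left_cancel h
    have hk : Complex.I ^ (k : ℕ) = Complex.I ^ (k' : ℕ) := by
      have := congrArg Units.val hk
      rw [hApow, hApow] at this
      simpa using congrArg (fun M : Matrix (Fin 2) (Fin 2) ℂ => M 1 1) this
    have hk : k = k' := Fin.ext <| pow_injOn_Iio_orderOf (by simp [hIo]) (by simp [hIo]) hk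
    rw [hk]
  rw [← SetLike.coe_sort_coe, hrange, Nat.card_range_of_injective hinj]
  simp
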